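/- For every finite simple graph G, χ_rlid(G) ≤ χ_rlid(G\R). That is, if the maximal twin-free induced subgraph G\R of G admits an rlid-coloring with n colors, then G admits an rlid-coloring with at most n colors. -/

import Mathlib

open SimpleGraph

variable {V : Type*}

/-- The closed neighborhood `N[u]` of a vertex `u`. -/
def closedNbhd (G : SimpleGraph V) (u : V) : Set V := insert u (G.neighborSet u)

/-- Two vertices are twins if they have the same closed neighborhood. -/
def Twins (G : SimpleGraph V) (u v : V) : Prop := closedNbhd G u = closedNbhd G v

/-- `c` is a relaxed locally identifying (rlid-) coloring of `G`: every pair of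
adjacent non-twin vertices gets distinct color sets on their closed neighborhoods. -/
def IsRlidColoring {α : Type*} (G : SimpleGraph V) (c : V → α) : Prop :=
  ∀ u v : V, G.Adj u v → ¬ Twins G u v → c '' closedNbhd G u ≠ c '' closedNbhd G v

/-- `χ_rlid(G)`: the minimum number of colors in an rlid-coloring of `G`. -/
noncomputable def chiRlid (G : SimpleGraph V) : ℕ :=
  sInf {n | ∃ c : V → Fin n, IsRlidColoring G c}

/-- `s` is a set of representatives of the twin-equivalence classes of `G`:
it contains exactly one vertex from each class. The induced subgraph of `G` on
such a set is the maximal twin-free induced subgraph `G\R` (the quotient of `G`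
by the twin relation `R`), well-defined up to isomorphism. -/
def IsRepSet (G : SimpleGraph V) (s : Finset V) : Prop :=
  ∀ v : V, ∃! w, w ∈ s ∧ Twins G v w

theorem mem_closedNbhd {G : SimpleGraph V} {u v : V} :
    v ∈ closedNbhd G u ↔ v = u ∨ G.Adj u v := by
  simp [closedNbhd]

theorem mem_closedNbhd_comm {G : SimpleGraph V} {u v : V} :
    v ∈ closedNbhd G u ↔ u ∈ closedNbhd G v := by
  simp only [mem_closedNbhd, G.adj_comm u v, eq_comm]

/-- Replacing a vertex by a twin does not change which closed neighborhoods it belongs to. -/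
theorem Twins.mem_closedNbhd_iff {G : SimpleGraph V} {v w : V} (h : Twins G v w) (u : V) :
    v ∈ closedNbhd G u ↔ w ∈ closedNbhd G u := by
  unfold Twins at h
  rw [mem_closedNbhd_comm, h, mem_closedNbhd_comm]

theorem mem_closedNbhd_induce {G : SimpleGraph V} {t : Set V} {u v : t} :
    v ∈ closedNbhd (G.induce t) u ↔ (v : V) ∈ closedNbhd G u := by
  simp [mem_closedNbhd, Subtype.ext_iff]

/-- An injective coloring is an rlid-coloring. -/
theorem IsRlidColoring.of_injective {α : Type*} (G : SimpleGraph V) {c : V → α}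
    (hc : Function.Injective c) : IsRlidColoring G c :=
  fun _ _ _ htw h => htw (hc.image_injective h)

/-- A finite graph has an rlid-coloring with `chiRlid G` colors. -/
theorem exists_isRlidColoring_chiRlid [Finite V] (G : SimpleGraph V) :
    ∃ c : V → Fin (chiRlid G), IsRlidColoring G c :=
  Nat.sInf_mem (s := {n | ∃ c : V → Fin n, IsRlidColoring G c})
    ⟨Nat.card V, Finite.equivFin V, .of_injective G (Finite.equivFin V).injective⟩

/-- If `r` retracts `G` onto `t` by sending each vertex to a twin, then it maps closed
neighborhoods onto closed neighborhoods of the induced subgraph. -/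
theorem image_closedNbhd_of_twins {G : SimpleGraph V} {t : Set V} {r : V → t}
    (hr : ∀ v, Twins G v (r v)) (hrt : ∀ x : t, r x = x) (u : V) :
    r '' closedNbhd G u = closedNbhd (G.induce t) (r u) := by
  have hN : closedNbhd G u = closedNbhd G (r u) := hr u
  ext x
  rw [mem_closedNbhd_induce, ← hN]
  constructor
  · rintro ⟨w, hw, rfl⟩
    exact ((hr w).mem_closedNbhd_iff u).1 hw
  · exact fun hx => ⟨x, hx, hrt x⟩

/-- An rlid-coloring of the subgraph induced on `t` pulls back to `G` along a retraction onto `t`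
that sends each vertex to a twin. -/
theorem IsRlidColoring.comp_of_twins {α : Type*} {G : SimpleGraph V} {t : Set V} {r : V → t}
    {c : t → α} (hc : IsRlidColoring (G.induce t) c)
    (hr : ∀ v, Twins G v (r v)) (hrt : ∀ x : t, r x = x) : IsRlidColoring G (c ∘ r) := by
  have hmem (u w : V) : w ∈ closedNbhd G u ↔ r w ∈ closedNbhd (G.induce t) (r u) := by
    have hN : closedNbhd G u = closedNbhd G (r u) := hr u
    rw [mem_closedNbhd_induce, ← hN, (hr w).mem_closedNbhd_iff]
  intro u v huv htw
  have htw' : ¬ Twins (G.induce t) (r u) (r v) := by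
    intro h
    unfold Twins at h
    refine htw (Set.ext fun w => ?_)
    rw [hmem, hmem, h]
  have hadj : (G.induce t).Adj (r u) (r v) := by
    refine (mem_closedNbhd.1 ((hmem u v).1 (mem_closedNbhd.2 (.inr huv)))).resolve_left ?_
    exact fun h => htw' (congrArg _ h.symm)
  rw [Set.image_comp, Set.image_comp, image_closedNbhd_of_twins hr hrt,
    image_closedNbhd_of_twins hr hrt]
  exact hc _ _ hadj htw'

/-- For every finite simple graph `G`, `χ_rlid(G) ≤ χ_rlid(G\R)`. -/
theorem chiRlid_le_chiRlid_quotient [Fintype V] (G : SimpleGraph V)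
    (s : Finset V) (hs : IsRepSet G s) :
    chiRlid G ≤ chiRlid (G.induce (↑s : Set V)) := by
  obtain ⟨c, hc⟩ := exists_isRlidColoring_chiRlid (G.induce (↑s : Set V))
  choose r hr hr' using hs
  exact Nat.sInf_le ⟨_, hc.comp_of_twins (r := fun v => ⟨r v, (hr v).1⟩) (fun v => (hr v).2)
    fun x => Subtype.ext (hr' x x ⟨x.2, rfl⟩).symm⟩
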